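/- Let X and Y be discrete random variables taking values in a finite set 𝒳 and in 𝒴 = {-1,1} respectively, with joint distribution P, and let f : 𝒳 → 𝒵 with F = f(X). If the map x ↦ P(Y=1|X=x) takes at least three distinct values on the support of P_X, but f takes at most two distinct values on the support of P_X, then I_P(F;Y) < I_P(X;Y); hence no {-1,1}-valued classifier (in particular no margin maximizer, which satisfies |f(x)| = 1 everywhere) can be lossless on such a distribution. -/

import Mathlib

open Finset

noncomputable section

/-- The binary label space `𝒴 = {-1, 1} ⊆ ℤ`. -/
abbrev Ybin : Type := ({-1, 1} : Finset ℤ)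

/-- The label `+1` as an element of `Ybin`. -/
def yPos : Ybin := ⟨1, by decide⟩

/-- The label `-1` as an element of `Ybin`. -/
def yNeg : Ybin := ⟨-1, by decide⟩

/-- Probability of a set under a finitely supported pmf `P`. -/
def pr {Ω : Type*} [Fintype Ω] (P : Ω → ℝ) (s : Set Ω) : ℝ :=
  ∑ ω, s.indicator P ω

/-- Entropy `H_P(A)` of a random variable `A` (a function of the sample point),
`H_P(A) = -∑_a P(A=a) log P(A=a)`, written as a sum over sample points. -/
def ent {Ω α : Type*} [Fintype Ω] (P : Ω → ℝ) (A : Ω → α) : ℝ :=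
  -∑ ω, P ω * Real.log (pr P {ω' | A ω' = A ω})

/-- Conditional entropy `H_P(A|B) = -∑_{a,b} P(A=a,B=b) log P(A=a|B=b)`. -/
def condEnt {Ω α β : Type*} [Fintype Ω] (P : Ω → ℝ) (A : Ω → α) (B : Ω → β) : ℝ :=
  -∑ ω, P ω * Real.log (pr P {ω' | A ω' = A ω ∧ B ω' = B ω} / pr P {ω' | B ω' = B ω})

/-- Mutual information `I_P(A;B) = ∑_{a,b} P(A=a,B=b) log (P(A=a,B=b) / (P(A=a) P(B=b)))`. -/
def mi {Ω α β : Type*} [Fintype Ω] (P : Ω → ℝ) (A : Ω → α) (B : Ω → β) : ℝ :=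
  ∑ ω, P ω * Real.log (pr P {ω' | A ω' = A ω ∧ B ω' = B ω} /
      (pr P {ω' | A ω' = A ω} * pr P {ω' | B ω' = B ω}))

/-- Marginal `P_X(x) = ∑_y P(x,y)`. -/
def margX {𝒳 : Type*} [Fintype 𝒳] (P : 𝒳 × Ybin → ℝ) (x : 𝒳) : ℝ :=
  ∑ y, P (x, y)

/-- Risk `R_P(h) = P[sign(h(X)) ≠ Y]`. -/
def risk {𝒳 : Type*} [Fintype 𝒳] (P : 𝒳 × Ybin → ℝ) (h : 𝒳 → ℝ) : ℝ :=
  pr P {ω | Real.sign (h ω.1) ≠ ((ω.2 : ℤ) : ℝ)}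


theorem pr_nonneg {Ω : Type*} [Fintype Ω] {P : Ω → ℝ} (hP : ∀ ω, 0 ≤ P ω) (s : Set Ω) :
    0 ≤ pr P s :=
  Finset.sum_nonneg fun _ _ => Set.indicator_nonneg (fun ω _ => hP ω) _

theorem pr_mono {Ω : Type*} [Fintype Ω] {P : Ω → ℝ} (hP : ∀ ω, 0 ≤ P ω) {s t : Set Ω}
    (hst : s ⊆ t) : pr P s ≤ pr P t :=
  Finset.sum_le_sum fun _ _ => Set.indicator_le_indicator_of_subset hst hP _

theorem le_pr_of_mem {Ω : Type*} [Fintype Ω] {P : Ω → ℝ} (hP : ∀ ω, 0 ≤ P ω) {s : Set Ω}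
    {ω : Ω} (hω : ω ∈ s) : P ω ≤ pr P s := by
  have h := Finset.single_le_sum (f := s.indicator P)
    (fun i _ => Set.indicator_nonneg (fun ω _ => hP ω) i) (Finset.mem_univ ω)
  rwa [Set.indicator_of_mem hω] at h

theorem sum_pr_fiber {Ω β : Type*} [Fintype Ω] [Fintype β] (P : Ω → ℝ) (p : Ω → Prop)
    (B : Ω → β) : ∑ b, pr P {ω | p ω ∧ B ω = b} = pr P {ω | p ω} := by
  classical
  unfold pr
  rw [Finset.sum_comm]
  refine Finset.sum_congr rfl fun ω _ => ?_
  by_cases h : p ω <;> simp [Set.indicator_apply, h]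

theorem pr_fst_eq_and_snd_eq {α β : Type*} [Fintype α] [Fintype β] (P : α × β → ℝ) (ω : α × β) :
    pr P {ω' | ω'.1 = ω.1 ∧ ω'.2 = ω.2} = P ω := by
  classical
  unfold pr
  simp [Set.indicator_apply, ← Prod.ext_iff]

theorem pr_fst_eq {𝒳 : Type*} [Fintype 𝒳] (P : 𝒳 × Ybin → ℝ) (x : 𝒳) :
    pr P {ω | ω.1 = x} = margX P x := by
  rw [← sum_pr_fiber P (fun ω => ω.1 = x) (fun ω => ω.2)]
  exact Finset.sum_congr rfl fun y _ => pr_fst_eq_and_snd_eq P (x, y)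

theorem sub_lt_mul_neg_log_div {p r : ℝ} (hp : 0 < p) (hr : 0 < r) (h : r ≠ p) :
    p - r < p * -Real.log (r / p) := by
  have h1 : Real.log (r / p) < r / p - 1 :=
    Real.log_lt_sub_one_of_pos (div_pos hr hp) (by rwa [Ne, div_eq_one_iff_eq hp.ne'])
  have h2 := mul_lt_mul_of_pos_left h1 hp
  have h3 : p * (r / p - 1) = r - p := by field_simp
  linarith

theorem mi_comp_fst_lt {𝒳 𝒵 : Type*} [Fintype 𝒳] {P : 𝒳 × Ybin → ℝ} (hP0 : ∀ ω, 0 ≤ P ω)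
    (f : 𝒳 → 𝒵)
    (hne : ∃ ω : 𝒳 × Ybin, margX P ω.1 * (pr P {ω' | f ω'.1 = f ω.1 ∧ ω'.2 = ω.2} /
      pr P {ω' | f ω'.1 = f ω.1}) ≠ P ω) :
    mi P (fun ω => f ω.1) (fun ω => ω.2) < mi P (fun ω => ω.1) (fun ω => ω.2) := by
  set R : 𝒳 × Ybin → ℝ := fun ω => margX P ω.1 *
    (pr P {ω' | f ω'.1 = f ω.1 ∧ ω'.2 = ω.2} / pr P {ω' | f ω'.1 = f ω.1}) with hR
  have hm0 : ∀ x, 0 ≤ margX P x := fun x => Finset.sum_nonneg fun y _ => hP0 _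
  have hR0 : ∀ ω, 0 ≤ R ω := fun ω =>
    mul_nonneg (hm0 _) (div_nonneg (pr_nonneg hP0 _) (pr_nonneg hP0 _))
  have hsum : ∑ ω, (P ω - R ω) = 0 := by
    rw [Finset.sum_sub_distrib, sub_eq_zero, Fintype.sum_prod_type, Fintype.sum_prod_type]
    refine Finset.sum_congr rfl fun x _ => ?_
    simp only [hR]
    rw [← Finset.mul_sum, ← Finset.sum_div, sum_pr_fiber P (fun ω => f ω.1 = f x) (fun ω => ω.2)]
    change margX P x = _
    rcases (hm0 x).eq_or_lt with h | h
    · simp [← h]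
    · have hM : 0 < pr P {ω | f ω.1 = f x} := by
        refine h.trans_le ?_
        rw [← pr_fst_eq]
        exact pr_mono hP0 fun ω hω => congrArg f hω
      rw [div_self hM.ne', mul_one]
  have hterm : ∀ ω, 0 < P ω → 0 < R ω ∧
      P ω * -Real.log (R ω / P ω) =
      P ω * Real.log (pr P {ω' | ω'.1 = ω.1 ∧ ω'.2 = ω.2} /
        (pr P {ω' | ω'.1 = ω.1} * pr P {ω' | ω'.2 = ω.2})) -
      P ω * Real.log (pr P {ω' | f ω'.1 = f ω.1 ∧ ω'.2 = ω.2} /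
        (pr P {ω' | f ω'.1 = f ω.1} * pr P {ω' | ω'.2 = ω.2})) := by
    intro ω hω
    have hm : 0 < margX P ω.1 := by
      rw [← pr_fst_eq]
      exact hω.trans_le (le_pr_of_mem hP0 rfl)
    have hq : 0 < pr P {ω' | ω'.2 = ω.2} := hω.trans_le (le_pr_of_mem hP0 rfl)
    have hJ : 0 < pr P {ω' | f ω'.1 = f ω.1 ∧ ω'.2 = ω.2} :=
      hω.trans_le (le_pr_of_mem hP0 ⟨rfl, rfl⟩)
    have hM : 0 < pr P {ω' | f ω'.1 = f ω.1} := hω.trans_le (le_pr_of_mem hP0 rfl)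
    have hRω : 0 < R ω := mul_pos hm (div_pos hJ hM)
    refine ⟨hRω, ?_⟩
    rw [pr_fst_eq_and_snd_eq, pr_fst_eq, ← mul_sub,
      ← Real.log_div (by positivity) (by positivity), ← Real.log_inv]
    congr 2
    simp only [hR]
    field_simp
  have hlt : ∀ ω, R ω ≠ P ω → P ω - R ω <
      P ω * Real.log (pr P {ω' | ω'.1 = ω.1 ∧ ω'.2 = ω.2} /
        (pr P {ω' | ω'.1 = ω.1} * pr P {ω' | ω'.2 = ω.2})) -
      P ω * Real.log (pr P {ω' | f ω'.1 = f ω.1 ∧ ω'.2 = ω.2} /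
        (pr P {ω' | f ω'.1 = f ω.1} * pr P {ω' | ω'.2 = ω.2})) := by
    intro ω hω
    rcases (hP0 ω).eq_or_lt with h | h
    · rw [← h] at hω ⊢
      simpa using (hR0 ω).lt_of_ne' hω
    · rw [← (hterm ω h).2]
      exact sub_lt_mul_neg_log_div h (hterm ω h).1 hω
  have hle : ∀ ω, P ω - R ω ≤
      P ω * Real.log (pr P {ω' | ω'.1 = ω.1 ∧ ω'.2 = ω.2} /
        (pr P {ω' | ω'.1 = ω.1} * pr P {ω' | ω'.2 = ω.2})) -
      P ω * Real.log (pr P {ω' | f ω'.1 = f ω.1 ∧ ω'.2 = ω.2} /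
        (pr P {ω' | f ω'.1 = f ω.1} * pr P {ω' | ω'.2 = ω.2})) := by
    intro ω
    by_cases hω : R ω = P ω
    · rcases (hP0 ω).eq_or_lt with h | h
      · rw [hω, ← h]
        simp
      · rw [← (hterm ω h).2, hω, div_self h.ne']
        simp
    · exact (hlt ω hω).le
  obtain ⟨ω₀, hω₀⟩ := hne
  have key := Finset.sum_lt_sum (fun ω _ => hle ω) ⟨ω₀, Finset.mem_univ ω₀, hlt ω₀ hω₀⟩
  rw [hsum, Finset.sum_sub_distrib] at key
  exact sub_pos.mp key

/-- If `x ↦ P(Y=1|X=x)` takes at least three distinct values on the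
support of `P_X`, but `f` takes at most two distinct values there, then
`I_P(F;Y) < I_P(X;Y)`; hence no `{-1,1}`-valued classifier can be lossless on such a
distribution. -/
theorem not_lossless_of_two_valued_model {𝒳 𝒵 : Type*} [Fintype 𝒳]
    (P : 𝒳 × Ybin → ℝ) (hP0 : ∀ ω, 0 ≤ P ω) (hP1 : ∑ ω, P ω = 1)
    (f : 𝒳 → 𝒵)
    (hthree : ∃ x₁ x₂ x₃ : 𝒳, 0 < margX P x₁ ∧ 0 < margX P x₂ ∧ 0 < margX P x₃ ∧
      P (x₁, yPos) / margX P x₁ ≠ P (x₂, yPos) / margX P x₂ ∧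
      P (x₁, yPos) / margX P x₁ ≠ P (x₃, yPos) / margX P x₃ ∧
      P (x₂, yPos) / margX P x₂ ≠ P (x₃, yPos) / margX P x₃)
    (htwo : ∃ z₁ z₂ : 𝒵, ∀ x : 𝒳, 0 < margX P x → f x = z₁ ∨ f x = z₂) :
    mi P (fun ω => f ω.1) (fun ω => ω.2) < mi P (fun ω => ω.1) (fun ω => ω.2) := by
  obtain ⟨x₁, x₂, x₃, h₁, h₂, h₃, h₁₂, h₁₃, h₂₃⟩ := hthree
  obtain ⟨z₁, z₂, hz⟩ := htwo
  refine mi_comp_fst_lt hP0 f ?_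
  by_contra! hall
  have hcond : ∀ x x', 0 < margX P x → 0 < margX P x' → f x = f x' →
      P (x, yPos) / margX P x = P (x', yPos) / margX P x' := by
    intro x x' hx hx' hf
    rw [← hall (x, yPos), ← hall (x', yPos), mul_div_cancel_left₀ _ hx.ne',
      mul_div_cancel_left₀ _ hx'.ne', hf]
  have c₁₂ := fun h => h₁₂ (hcond x₁ x₂ h₁ h₂ h)
  have c₁₃ := fun h => h₁₃ (hcond x₁ x₃ h₁ h₃ h)
  have c₂₃ := fun h => h₂₃ (hcond x₂ x₃ h₂ h₃ h)
  have e₁ := hz x₁ h₁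
  have e₂ := hz x₂ h₂
  have e₃ := hz x₃ h₃
  grind
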